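/- arXiv:math/0505088 — 2 statements merged into one kernel-verified Lean document; each statement's English description precedes it below -/
import Mathlib

section
/- For the plane curve y = f(x) = a₂x² + a₄x⁴ + a₅x⁵ + ... with a₂ ≠ 0, the degree-5 part of the pre-symmetry set equation g(s,t) = (γ(s)−γ(t))·(T(s)−T(t)) factorizes as 2a₂(a₂³ − a₄)(s+t)(s−t)⁴. In particular, if a₂³ ≠ a₄ (ordinary vertex, exact A₃ contact), the zero set of g near the origin, apart from the diagonal s = t, is a smooth curve of the form s + t + higher order terms = 0, transverse to the diagonal. -/
open Asymptotics

/-- Unit tangent vector of the graph curve `γ(x) = (x, f(x))`. -/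
noncomputable def tangentG (f : ℝ → ℝ) (x : ℝ) : ℝ × ℝ :=
  (Real.sqrt (1 + (deriv f x)^2))⁻¹ • ((1 : ℝ), deriv f x)

/-- The pre-symmetry set defining function `g(s,t) = (γ(s) − γ(t))·(T(s) − T(t))`
for the graph curve `γ(x) = (x, f(x))`. -/
noncomputable def preG (f : ℝ → ℝ) (s t : ℝ) : ℝ :=
  (s - t) * ((tangentG f s).1 - (tangentG f t).1) +
    (f s - f t) * ((tangentG f s).2 - (tangentG f t).2)


section helpers
open Set Filter Topology MeasureTheory

lemma aux_param_nat (n : ℕ) : ∀ {F : Type} [NormedAddCommGroup F] [NormedSpace ℝ F]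
    [CompleteSpace F]
    (G : (ℝ × ℝ) × ℝ → F), ContDiff ℝ n G →
    ContDiff ℝ n (fun x : ℝ × ℝ => ∫ u in (0:ℝ)..1, G (x, u)) := by
  induction n with
  | zero =>
    intro F _ _ _ G hG
    have hc : Continuous G := hG.continuous
    have : Continuous (fun x : ℝ × ℝ => ∫ u in (0:ℝ)..1, G (x, u)) :=
      intervalIntegral.continuous_parametric_intervalIntegral_of_continuous'
        (f := fun x u => G (x, u)) hc 0 1
    exact_mod_cast (contDiff_zero (𝕜 := ℝ)).2 this
  | succ n ih =>
    intro F _ _ _ G hG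
    push_cast
    rw [contDiff_succ_iff_hasFDerivAt]
    let G' : (ℝ × ℝ) × ℝ → (ℝ × ℝ) →L[ℝ] F := fun p =>
      (fderiv ℝ G p).comp (ContinuousLinearMap.inl ℝ (ℝ × ℝ) ℝ)
    have hG' : ContDiff ℝ n G' := by
      have h1 : ContDiff ℝ n (fderiv ℝ G) := hG.fderiv_right (by norm_cast)
      exact h1.clm_comp contDiff_const
    have hG'c : Continuous G' := hG'.continuous
    have hGc : Continuous G := hG.continuous
    refine ⟨fun x => ∫ u in (0:ℝ)..1, G' (x, u), ih G' hG', ?_⟩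
    intro x
    obtain ⟨C, hC⟩ := ((isCompact_closedBall x 1).prod (isCompact_Icc (a := (0:ℝ)) (b := 1))).exists_bound_of_continuousOn
      hG'c.continuousOn
    refine intervalIntegral.hasFDerivAt_integral_of_dominated_of_fderiv_le (𝕜 := ℝ)
      (F := fun x u => G (x, u)) (F' := fun x u => G' (x, u)) (bound := fun _ => C)
      (Metric.closedBall_mem_nhds x one_pos) ?_ ?_ ?_ ?_ ?_ ?_
    · refine Eventually.of_forall fun y => ?_
      exact (hGc.comp (by fun_prop : Continuous fun u : ℝ => (y, u))).aestronglyMeasurable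
    · exact (hGc.comp (by fun_prop : Continuous fun u : ℝ => (x, u))).intervalIntegrable _ _
    · exact (hG'c.comp (by fun_prop : Continuous fun u : ℝ => (x, u))).aestronglyMeasurable
    · refine Eventually.of_forall fun u hu y hy => hC (y, u) ⟨hy, ?_⟩
      rw [uIoc_of_le zero_le_one] at hu
      exact ⟨hu.1.le, hu.2⟩
    · exact intervalIntegrable_const
    · refine Eventually.of_forall fun u hu y hy => ?_
      have h1 : HasFDerivAt G (fderiv ℝ G (y, u)) (y, u) :=
        (hG.differentiable (by simp) _).hasFDerivAt
      exact h1.comp y (hasFDerivAt_prodMk_left y u)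

lemma aux_param (G : (ℝ × ℝ) × ℝ → ℝ) (hG : ContDiff ℝ (⊤ : ℕ∞) G) :
    ContDiff ℝ (⊤ : ℕ∞) (fun x : ℝ × ℝ => ∫ u in (0:ℝ)..1, G (x, u)) := by
  rw [contDiff_infty]
  intro n
  exact aux_param_nat n G (hG.of_le (by exact_mod_cast le_top))

lemma aux_hadamard (G : ℝ × ℝ → ℝ) (hG : ContDiff ℝ (⊤ : ℕ∞) G) (h0 : ∀ m, G (0, m) = 0) :
    ∃ H : ℝ × ℝ → ℝ, ContDiff ℝ (⊤ : ℕ∞) H ∧ ∀ h m, G (h, m) = h * H (h, m) := by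
  have hfd : ContDiff ℝ (⊤ : ℕ∞) (fun p => fderiv ℝ G p (1, 0)) :=
    (hG.fderiv_right (m := (⊤ : ℕ∞)) (by simp)).clm_apply contDiff_const
  refine ⟨fun p => ∫ u in (0:ℝ)..1, fderiv ℝ G (u * p.1, p.2) (1, 0), ?_, ?_⟩
  · refine aux_param (fun q => fderiv ℝ G (q.2 * q.1.1, q.1.2) (1, 0)) ?_
    exact hfd.comp (g := fun p => fderiv ℝ G p (1, 0))
      (f := fun q : (ℝ × ℝ) × ℝ => (q.2 * q.1.1, q.1.2)) (by fun_prop)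
  · intro h m
    have hd : ∀ u ∈ uIcc (0:ℝ) 1, HasDerivAt (fun u : ℝ => G (u * h, m))
        (h * fderiv ℝ G (u * h, m) (1, 0)) u := by
      intro u _
      have h1 : HasFDerivAt G (fderiv ℝ G (u * h, m)) (u * h, m) :=
        (hG.differentiable (by simp) _).hasFDerivAt
      have h2 : HasDerivAt (fun u : ℝ => (u * h, m)) ((h, 0) : ℝ × ℝ) u := by
        have := (hasDerivAt_id u).mul_const h
        simpa using this.prodMk (hasDerivAt_const u m)
      have h3 := h1.comp_hasDerivAt u h2
      have h4 : ((h, 0) : ℝ × ℝ) = h • ((1, 0) : ℝ × ℝ) := by simp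
      rw [h4, map_smul, smul_eq_mul] at h3
      exact h3
    have hi := intervalIntegral.integral_eq_sub_of_hasDerivAt hd (by
      apply Continuous.intervalIntegrable
      have := hfd.continuous.comp (by fun_prop : Continuous fun u : ℝ => (u * h, m))
      exact continuous_const.mul this)
    simp only [one_mul, zero_mul, h0, sub_zero] at hi
    rw [← hi]
    simp

lemma aux_hadamard1 (q : ℝ → ℝ) (hq : ContDiff ℝ (⊤ : ℕ∞) q) (h0 : q 0 = 0) :
    ∃ r : ℝ → ℝ, ContDiff ℝ (⊤ : ℕ∞) r ∧ ∀ x, q x = x * r x := by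
  obtain ⟨H, hH, hH'⟩ := aux_hadamard (fun p => q p.1) (by fun_prop) (fun _ => h0)
  exact ⟨fun x => H (x, 0), by fun_prop, fun x => hH' x 0⟩

lemma aux_div (n : ℕ) : ∀ (q : ℝ → ℝ), ContDiff ℝ (⊤ : ℕ∞) q → 
    q =o[𝓝 0] (fun x : ℝ => x ^ n) →
    ∃ r : ℝ → ℝ, ContDiff ℝ (⊤ : ℕ∞) r ∧ ∀ x, q x = x ^ (n + 1) * r x := by
  have key : ∀ q : ℝ → ℝ, ContDiff ℝ (⊤ : ℕ∞) q → ∀ n : ℕ, q =o[𝓝 0] (fun x : ℝ => x ^ n) → q 0 = 0 := by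
    intro q hq n hn
    have h1 : q =o[𝓝 0] (fun _ : ℝ => (1:ℝ)) := by
      refine hn.trans_isBigO ?_
      have : Tendsto (fun x : ℝ => x ^ n) (𝓝 0) (𝓝 ((0:ℝ) ^ n)) := (by fun_prop : Continuous fun x : ℝ => x ^ n).tendsto 0
      exact this.isBigO_one ℝ
    rw [isLittleO_one_iff] at h1
    exact tendsto_nhds_unique (hq.continuous.tendsto 0) h1
  induction n with
  | zero => 
    intro q hq hn
    obtain ⟨r, hr, h⟩ := aux_hadamard1 q hq (key q hq _ hn)
    exact ⟨r, hr, by simpa using h⟩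
  | succ n ih =>
    intro q hq hn
    obtain ⟨r, hr, h⟩ := aux_hadamard1 q hq (key q hq _ hn)
    have hro : r =o[𝓝[≠] 0] (fun x : ℝ => x ^ n) := by
      have := hn.mono (nhdsWithin_le_nhds (s := {0}ᶜ))
      have h2 := (isBigO_refl (fun x : ℝ => x⁻¹) (𝓝[≠] 0)).mul_isLittleO this
      refine h2.congr' ?_ ?_
      · filter_upwards [self_mem_nhdsWithin] with x hx
        have hx : x ≠ 0 := hx
        rw [h]; field_simp
      · filter_upwards [self_mem_nhdsWithin] with x hx
        have hx : x ≠ 0 := hx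
        field_simp
        ring
    have hr0 : r 0 = 0 := by
      have h1 : r =o[𝓝[≠] 0] (fun _ : ℝ => (1:ℝ)) := by
        refine hro.trans_isBigO ?_
        have : Tendsto (fun x : ℝ => x ^ n) (𝓝 0) (𝓝 ((0:ℝ) ^ n)) := (by fun_prop : Continuous fun x : ℝ => x ^ n).tendsto 0
        exact (this.isBigO_one ℝ).mono nhdsWithin_le_nhds
      rw [isLittleO_one_iff] at h1
      exact tendsto_nhds_unique ((hr.continuous.tendsto 0).mono_left nhdsWithin_le_nhds) h1
    have hro' : r =o[𝓝 0] (fun x : ℝ => x ^ n) := by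
      rw [← pure_sup_nhdsNE]
      refine IsLittleO.sup ?_ hro
      refine IsLittleO.of_bound fun c hc => ?_
      simp only [eventually_pure, hr0, norm_zero]
      positivity
    obtain ⟨r', hr', h'⟩ := ih r hr hro'
    exact ⟨r', hr', fun x => by rw [h, h']; ring⟩

end helpers

section helpers2
open Set Filter Topology

lemma aux_T1 (f : ℝ → ℝ) (x : ℝ) :
    (tangentG f x).1 = (Real.sqrt (1 + (deriv f x)^2))⁻¹ := by simp [tangentG]

lemma aux_T2 (f : ℝ → ℝ) (x : ℝ) :
    (tangentG f x).2 = deriv f x * (Real.sqrt (1 + (deriv f x)^2))⁻¹ := by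
  simp [tangentG, mul_comm]

lemma aux_expand (a₂ a₄ a₅ : ℝ) (f : ℝ → ℝ) (hf : ContDiff ℝ (⊤ : ℕ∞) f)
    (hjet : (fun x => f x - (a₂*x^2 + a₄*x^4 + a₅*x^5)) =o[nhds (0:ℝ)] fun x => x^5) :
    ∃ Y S : ℝ → ℝ, Continuous Y ∧ Continuous S ∧ (∀ x, f x = a₂*x^2 + a₄*x^4 + x^5 * Y x) ∧
      (∀ x, deriv f x = 2*a₂*x + 4*a₄*x^3 + x^4 * S x) := by
  obtain ⟨R, hR, h⟩ := aux_div 5 _ (by fun_prop) hjet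
  have hfx : ∀ x, f x = a₂*x^2 + a₄*x^4 + a₅*x^5 + x^6 * R x := fun x => by
    have := h x
    linear_combination this
  have hRc := hR.continuous
  have hR'c : Continuous (deriv R) := hR.continuous_deriv (by simp)
  refine ⟨fun x => a₅ + x * R x, fun x => 5*a₅ + 6*x*R x + x^2*deriv R x, by fun_prop,
    by fun_prop, fun x => by rw [hfx]; ring, fun x => ?_⟩
  have hRd : HasDerivAt R (deriv R x) x := (hR.differentiable (by simp) x).hasDerivAt
  have hd := ((((hasDerivAt_pow 2 x).const_mul a₂).add ((hasDerivAt_pow 4 x).const_mul a₄)).add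
    ((hasDerivAt_pow 5 x).const_mul a₅)).add ((hasDerivAt_pow 6 x).mul hRd)
  have : f = fun x => a₂*x^2 + a₄*x^4 + a₅*x^5 + x^6 * R x := funext hfx
  rw [this]
  refine (HasDerivAt.deriv hd).trans ?_
  push_cast
  ring

lemma aux_w (p : ℝ → ℝ) (hp : Continuous p) : ∃ Z : ℝ → ℝ, Continuous Z ∧ ∀ x,
    (Real.sqrt (1 + (p x)^2))⁻¹ = 1 - (p x)^2/2 + 3*(p x)^4/8 + (p x)^6 * Z x := by
  have hs : ∀ x, 0 < Real.sqrt (1 + (p x)^2) := fun x => by positivity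
  have hQ : ∀ x, 0 < 1 - (p x)^2/2 + 3*(p x)^4/8 := fun x => by
    nlinarith [sq_nonneg ((p x)^2 - 2/3)]
  have hD : ∀ x, (1 + (p x)^2) * ((Real.sqrt (1 + (p x)^2))⁻¹ +
    (1 - (p x)^2/2 + 3*(p x)^4/8)) ≠ 0 := fun x => by
    have := hQ x
    have := hs x
    positivity
  refine ⟨fun x => -(5/8 - 15/64 * (p x)^2 + 9/64*(p x)^4) /
    ((1 + (p x)^2) * ((Real.sqrt (1 + (p x)^2))⁻¹ + (1 - (p x)^2/2 + 3*(p x)^4/8))), ?_, ?_⟩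
  · refine Continuous.div (by fun_prop) ?_ hD
    refine Continuous.mul (by fun_prop) (Continuous.add ?_ (by fun_prop))
    exact Continuous.inv₀ (by fun_prop) fun x => (hs x).ne'
  · intro x
    have h1 : ((Real.sqrt (1 + (p x)^2))⁻¹)^2 * (1 + (p x)^2) = 1 := by
      rw [inv_pow, Real.sq_sqrt (by positivity)]
      exact inv_mul_cancel₀ (by positivity)
    have h2 := hD x
    simp only
    generalize (Real.sqrt (1 + (p x)^2))⁻¹ = w at *
    rw [← sub_eq_iff_eq_add', ← mul_div_assoc, eq_div_iff h2]
    linear_combination h1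

lemma aux_expand2 (a₂ a₄ a₅ : ℝ) (f : ℝ → ℝ) (hf : ContDiff ℝ (⊤ : ℕ∞) f)
    (hjet : (fun x => f x - (a₂*x^2 + a₄*x^4 + a₅*x^5)) =o[nhds (0:ℝ)] fun x => x^5) :
    ∃ Y U V : ℝ → ℝ, Continuous Y ∧ Continuous U ∧ Continuous V ∧
      (∀ x, f x = a₂*x^2 + a₄*x^4 + x^5 * Y x) ∧
      (∀ x, (tangentG f x).1 = 1 - 2*a₂^2*x^2 + (6*a₂^4 - 8*a₂*a₄)*x^4 + x^5 * U x) ∧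
      (∀ x, (tangentG f x).2 = 2*a₂*x + (4*a₄ - 4*a₂^3)*x^3 + x^4 * V x) := by
  obtain ⟨Y, S, hY, hS, hfx, hdx⟩ := aux_expand a₂ a₄ a₅ f hf hjet
  obtain ⟨Z, hZ, hw⟩ := aux_w (deriv f) (hf.continuous_deriv (by simp))
  let k : ℝ → ℝ := fun x => 2*a₂ + 4*a₄*x^2 + x^3*S x
  let k2 : ℝ → ℝ := fun x => 4*a₂*S x + 16*a₄^2*x + 8*a₄*x^2*S x + x^3*(S x)^2
  let k4 : ℝ → ℝ := fun x => (16*a₂*a₄ + x*k2 x)*((k x)^2 + 4*a₂^2)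
  let U : ℝ → ℝ := fun x => -(k2 x)/2 + 3/8*x*k4 x + x*(k x)^6*Z x
  let u4 : ℝ → ℝ := fun x => (6*a₂^4 - 8*a₂*a₄) + x * U x
  let V : ℝ → ℝ := fun x => S x*(1 - 2*a₂^2*x^2 + x^4*u4 x) + 2*a₂*x*u4 x +
    4*a₄*x*(-2*a₂^2 + x^2*u4 x)
  have hk : Continuous k := by fun_prop
  have hk2 : Continuous k2 := by fun_prop
  have hk4 : Continuous k4 := by fun_prop
  have hU : Continuous U := by fun_prop
  have hu4 : Continuous u4 := by fun_prop
  have hV : Continuous V := by fun_prop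
  have h1 : ∀ x, (Real.sqrt (1 + (deriv f x)^2))⁻¹ =
      1 - 2*a₂^2*x^2 + (6*a₂^4 - 8*a₂*a₄)*x^4 + x^5 * U x := by
    intro x
    have hpk : deriv f x = x * k x := by rw [hdx]; simp only [k]; ring
    have hkk : (k x)^2 = 4*a₂^2 + 16*a₂*a₄*x^2 + x^3*k2 x := by simp only [k, k2]; ring
    have hkkk : (k x)^4 = 16*a₂^4 + x^2 * k4 x := by
      simp only [k4]
      linear_combination (4*a₂^2 + (k x)^2) * hkk
    rw [hw, hpk]
    simp only [U]
    linear_combination -x^2/2 * hkk + 3/8*x^4*hkkk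
  refine ⟨Y, U, V, hY, hU, hV, hfx, fun x => by rw [aux_T1, h1], fun x => ?_⟩
  rw [aux_T2, h1, hdx]
  simp only [V, u4]
  ring

lemma aux_part1 (a₂ a₄ a₅ : ℝ) (f : ℝ → ℝ) (hf : ContDiff ℝ (⊤ : ℕ∞) f)
    (hjet : (fun x => f x - (a₂*x^2 + a₄*x^4 + a₅*x^5)) =o[nhds (0:ℝ)] fun x => x^5) :
    (fun p : ℝ × ℝ => preG f p.1 p.2 - 2*a₂*(a₂^3 - a₄)*(p.1+p.2)*(p.1-p.2)^4)
        =o[nhds (0 : ℝ × ℝ)] fun p : ℝ × ℝ => ‖p‖^5 := by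
  obtain ⟨Y, U, V, hY, hU, hV, hfx, h1, h2⟩ := aux_expand2 a₂ a₄ a₅ f hf hjet
  have hle : ∀ m n : ℕ, n ≤ m → (fun p : ℝ × ℝ => ‖p‖^m) =O[𝓝 0] fun p : ℝ × ℝ => ‖p‖^n := by
    intro m n hmn
    refine IsBigO.of_bound 1 ?_
    filter_upwards [Metric.closedBall_mem_nhds (0 : ℝ × ℝ) one_pos] with p hp
    have hp : ‖p‖ ≤ 1 := by simpa using hp
    simpa using pow_le_pow_of_le_one (norm_nonneg p) hp hmn
  have hs : ∀ n : ℕ, (fun p : ℝ × ℝ => p.1^n) =O[𝓝 0] fun p : ℝ × ℝ => ‖p‖^n := fun n =>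
    IsBigO.pow (IsBigO.of_bound 1 (Eventually.of_forall fun p => by simpa using norm_fst_le p)) n
  have ht : ∀ n : ℕ, (fun p : ℝ × ℝ => p.2^n) =O[𝓝 0] fun p : ℝ × ℝ => ‖p‖^n := fun n =>
    IsBigO.pow (IsBigO.of_bound 1 (Eventually.of_forall fun p => by simpa using norm_snd_le p)) n
  have hone : ∀ W : ℝ × ℝ → ℝ, Continuous W → W =O[𝓝 0] fun _ : ℝ × ℝ => (1:ℝ) := fun W hW =>
    (hW.tendsto 0).isBigO_one ℝ
  have hd : ∀ n : ℕ, (fun p : ℝ × ℝ => p.1^n - p.2^n) =O[𝓝 0] fun p : ℝ × ℝ => ‖p‖^n := fun n =>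
    (hs n).sub (ht n)
  have hdW : ∀ (n : ℕ) (W : ℝ → ℝ), Continuous W →
      (fun p : ℝ × ℝ => p.1^n * W p.1 - p.2^n * W p.2) =O[𝓝 0] fun p : ℝ × ℝ => ‖p‖^n := by
    intro n W hW
    have e1 := (hs n).mul (hone (fun p => W p.1) (by fun_prop))
    have e2 := (ht n).mul (hone (fun p => W p.2) (by fun_prop))
    simpa using e1.sub e2
  have hmul : ∀ (i j : ℕ), 6 ≤ i + j → ∀ A B : ℝ × ℝ → ℝ, A =O[𝓝 0] (fun p : ℝ × ℝ => ‖p‖^i) →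
      B =O[𝓝 0] (fun p : ℝ × ℝ => ‖p‖^j) →
      (fun p => A p * B p) =O[𝓝 0] (fun p : ℝ × ℝ => ‖p‖^6) := by
    intro i j hij A B hA hB
    have := hA.mul hB
    simp only [← pow_add] at this
    exact this.trans (hle _ _ hij)
  have t1 := hmul 1 5 (by norm_num) _ _ (hd 1) (hdW 5 U hU)
  have t2 := hmul 2 4 (by norm_num) _ _ ((hd 2).const_mul_left a₂) (hdW 4 V hV)
  have t3 := hmul 4 3 (by norm_num) _ _ ((hd 4).const_mul_left a₄)
    (((hd 3).const_mul_left (4*a₄ - 4*a₂^3)).add ((hdW 4 V hV).trans (hle 4 3 (by norm_num))))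
  have t4 := hmul 5 1 (by norm_num) _ _ (hdW 5 Y hY)
    (((hd 1).const_mul_left (2*a₂)).add (((hd 3).const_mul_left (4*a₄ - 4*a₂^3)).trans
      (hle 3 1 (by norm_num)) |>.add ((hdW 4 V hV).trans (hle 4 1 (by norm_num)))))
  have hO := ((t1.add t2).add t3).add t4
  have ho : (fun p : ℝ × ℝ => ‖p‖^6) =o[𝓝 0] fun p : ℝ × ℝ => ‖p‖^5 := by
    have e1 : (fun p : ℝ × ℝ => ‖p‖) =o[𝓝 0] fun _ : ℝ × ℝ => (1:ℝ) := by
      rw [isLittleO_one_iff]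
      exact tendsto_norm_zero
    have := e1.mul_isBigO (isBigO_refl (fun p : ℝ × ℝ => ‖p‖^5) (𝓝 0))
    refine this.congr (fun p => by ring) (fun p => by ring)
  refine (hO.trans_isLittleO ho).congr_left fun p => ?_
  simp only [preG, h1, h2, hfx]
  ring

end helpers2

section helpers3
open Set Filter Topology

lemma aux_ext (u v : ℝ → ℝ) (hu : Continuous u) (hv : Continuous v) (h : ∀ x, x ≠ 0 → u x = v x) :
    ∀ x, u x = v x := by
  have := Continuous.ext_on (dense_compl_singleton (0:ℝ)) hu hv (fun x hx => h x hx)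
  exact fun x => congrFun this x

lemma aux_odd (u : ℝ → ℝ) (hu : Continuous u) (h : ∀ x, x ≠ 0 → u (-x) = - u x) : u 0 = 0 := by
  have := aux_ext (fun x => u (-x)) (fun x => - u x) (by fun_prop) (by fun_prop) h 0
  simp only [neg_zero] at this
  linarith

lemma aux_diff (q : ℝ → ℝ) (hq : ContDiff ℝ (⊤ : ℕ∞) q) : ∃ A : ℝ × ℝ → ℝ,
    ContDiff ℝ (⊤ : ℕ∞) A ∧ (∀ h m, q (m + h) - q (m - h) = h * A (h, m)) ∧
    ∀ m, A (0, m) = 2 * deriv q m := by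
  obtain ⟨A, hA, h⟩ := aux_hadamard (fun p => q (p.2 + p.1) - q (p.2 - p.1)) (by fun_prop)
    (fun m => by simp)
  refine ⟨A, hA, h, fun m => ?_⟩
  have hqd : HasDerivAt q (deriv q m) m := (hq.differentiable (by simp) m).hasDerivAt
  have d1 : HasDerivAt (fun h : ℝ => q (m + h)) (deriv q m) 0 := by
    have e : HasDerivAt q (deriv q m) (m + 0) := by simpa using hqd
    exact e.comp_const_add m 0
  have d2 : HasDerivAt (fun h : ℝ => q (m - h)) (-deriv q m) 0 := by
    have e : HasDerivAt q (deriv q m) (m - 0) := by simpa using hqd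
    exact e.comp_const_sub m 0
  have d3 := d1.sub d2
  have hAd : DifferentiableAt ℝ (fun h : ℝ => A (h, m)) 0 := by
    have : ContDiff ℝ (⊤ : ℕ∞) (fun h : ℝ => A (h, m)) := by fun_prop
    exact this.differentiable (by simp) 0
  have d4 := (hasDerivAt_id (0:ℝ)).mul hAd.hasDerivAt
  have e : ((fun h : ℝ => q (m + h)) - fun h : ℝ => q (m - h)) = id * fun h => A (h, m) := by
    funext h'
    exact h h' m
  rw [e] at d3
  have := d4.unique d3
  simp at this
  linarith

lemma aux_smooth (f : ℝ → ℝ) (hf : ContDiff ℝ (⊤ : ℕ∞) f) :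
    ContDiff ℝ (⊤ : ℕ∞) (fun x => (tangentG f x).1) ∧
    ContDiff ℝ (⊤ : ℕ∞) (fun x => (tangentG f x).2) := by
  have hd : ContDiff ℝ (⊤ : ℕ∞) (deriv f) := (contDiff_infty_iff_deriv.1 hf).2
  have h1 : ContDiff ℝ (⊤ : ℕ∞) (fun x => (Real.sqrt (1 + (deriv f x)^2))⁻¹) := by
    refine ContDiff.inv (ContDiff.sqrt (by fun_prop) fun x => by positivity) fun x => by positivity
  constructor
  · simpa only [aux_T1] using h1
  · simpa only [aux_T2] using hd.mul h1

lemma aux_perp (f : ℝ → ℝ) (hf : ContDiff ℝ (⊤ : ℕ∞) f) (x : ℝ) :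
    deriv (fun x => (tangentG f x).1) x + deriv f x * deriv (fun x => (tangentG f x).2) x = 0 := by
  obtain ⟨h1, h2⟩ := aux_smooth f hf
  have d1 := (h1.differentiable (by simp) x).hasDerivAt
  have d2 := (h2.differentiable (by simp) x).hasDerivAt
  have d := (d1.pow 2).add (d2.pow 2)
  have e : ((fun x => (tangentG f x).1)^2 + (fun x => (tangentG f x).2)^2) = fun _ => (1:ℝ) := by
    funext y
    simp only [Pi.add_apply, Pi.pow_apply, aux_T1, aux_T2, mul_pow, inv_pow]
    rw [Real.sq_sqrt (by positivity)]
    have : (1 + (deriv f y)^2) ≠ 0 := by positivity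
    field_simp
  rw [e] at d
  have := d.unique (hasDerivAt_const x (1:ℝ))
  have hpos : (tangentG f x).1 ≠ 0 := by
    rw [aux_T1]; positivity
  have h2x : (tangentG f x).2 = deriv f x * (tangentG f x).1 := by rw [aux_T1, aux_T2]
  rw [h2x] at this
  apply mul_left_cancel₀ hpos
  norm_num at this
  linear_combination this / 2

lemma aux_L (f : ℝ → ℝ) (hf : ContDiff ℝ (⊤ : ℕ∞) f) : ∃ L : ℝ × ℝ → ℝ,
    ContDiff ℝ (⊤ : ℕ∞) L ∧ ∀ h m, preG f (m + h) (m - h) = h^4 * L (h, m) := by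
  obtain ⟨h1, h2⟩ := aux_smooth f hf
  obtain ⟨A, hA, hA1, hA2⟩ := aux_diff _ h1
  obtain ⟨B, hB, hB1, hB2⟩ := aux_diff _ h2
  obtain ⟨C, hC, hC1, hC2⟩ := aux_diff _ hf
  have hK : ∀ h m, preG f (m + h) (m - h) = h^2 * (2 * A (h, m) + C (h, m) * B (h, m)) := by
    intro h m
    rw [preG, hA1, hB1, hC1]
    ring
  obtain ⟨K1, hK1, hK1'⟩ := aux_hadamard (fun p => 2 * A p + C p * B p) (by fun_prop)
    (fun m => by
      simp only [hA2, hB2, hC2]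
      linear_combination 4 * aux_perp f hf m)
  have hsym : ∀ h m, preG f (m + h) (m - h) = preG f (m + -h) (m - -h) := by
    intro h m
    rw [sub_neg_eq_add, ← sub_eq_add_neg]
    simp only [preG]
    ring
  obtain ⟨L, hL, hL'⟩ := aux_hadamard K1 hK1 (fun m => by
    refine aux_odd (fun h => K1 (h, m)) (by have := hK1.continuous; fun_prop) fun x hx => ?_
    have := hsym x m
    rw [hK, hK, hK1', hK1'] at this
    have hx3 : x^3 ≠ 0 := pow_ne_zero _ hx
    apply mul_left_cancel₀ hx3
    linear_combination this)
  refine ⟨L, hL, fun h m => ?_⟩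
  rw [hK, hK1', hL']
  ring

lemma aux_ray (k : ℝ) (u : ℝ → ℝ) (hu : ContDiff ℝ (⊤ : ℕ∞) u)
    (h : (fun x => x^4 * u x - k * x^5) =o[𝓝 0] fun x : ℝ => x^5) :
    u 0 = 0 ∧ HasDerivAt u k 0 := by
  obtain ⟨r, hr, hr'⟩ := aux_div 5 _ (by fun_prop) h
  have e := aux_ext u (fun x => k * x + x^2 * r x) hu.continuous
    (by have := hr.continuous; fun_prop) (fun x hx => by
      have := hr' x
      have hx4 : x^4 ≠ 0 := pow_ne_zero _ hx
      apply mul_left_cancel₀ hx4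
      linear_combination this)
  refine ⟨by simp [e 0], ?_⟩
  have d1 := ((hasDerivAt_id (0:ℝ)).const_mul k).add
    ((hasDerivAt_pow 2 (0:ℝ)).mul (hr.differentiable (by simp) 0).hasDerivAt)
  have : u = fun x => k * x + x^2 * r x := funext e
  rw [this]
  convert! d1 using 1
  simp

lemma aux_cut (u : ℝ → ℝ) (δ : ℝ) (hδ : 0 < δ)
    (hu : ∀ x, |x| < δ → ContDiffAt ℝ (⊤ : ℕ∞) u x) :
    ∃ v : ℝ → ℝ, ContDiff ℝ (⊤ : ℕ∞) v ∧ ∀ x, |x| < δ/3 → v x = u x := by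
  let b : ContDiffBump (0:ℝ) := ⟨δ/3, δ/2, by positivity, by linarith⟩
  refine ⟨fun x => b x * u x, ?_, fun x hx => ?_⟩
  · rw [contDiff_iff_contDiffAt]
    intro x
    by_cases hx : |x| < δ
    · exact b.contDiff.contDiffAt.mul (hu x hx)
    · have : (fun x => b x * u x) =ᶠ[𝓝 x] fun _ => 0 := by
        have ho : IsOpen {y : ℝ | δ/2 < |y|} := isOpen_lt continuous_const continuous_abs
        filter_upwards [ho.mem_nhds (show δ/2 < |x| by push Not at hx; linarith)] with y hy
        have : b y = 0 := b.zero_of_le_dist (by simpa using (le_of_lt hy))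
        simp [this]
      exact contDiffAt_const.congr_of_eventuallyEq this
  · have : b x = 1 := b.one_of_mem_closedBall (by simpa using hx.le)
    simp [this]

lemma aux_ift (M : ℝ × ℝ → ℝ) (hM : ContDiff ℝ (⊤ : ℕ∞) M) (h0 : M 0 = 0) (c : ℝ) (hc : c ≠ 0)
    (hs : fderiv ℝ M 0 (1, 0) = c) (ht : fderiv ℝ M 0 (0, 1) = c) :
    ∃ (ε : ℝ) (φ : ℝ → ℝ), 0 < ε ∧ ContDiff ℝ (⊤ : ℕ∞) φ ∧ φ 0 = 0 ∧
      deriv φ 0 = -1 ∧ ∀ s t : ℝ, |s| < ε → |t| < ε → (M (s, t) = 0 ↔ t = φ s) := by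
  have hM0 : HasFDerivAt M (fderiv ℝ M 0) 0 := (hM.differentiable (by simp) 0).hasFDerivAt
  have hMv : ∀ p : ℝ × ℝ, fderiv ℝ M 0 p = c * p.1 + c * p.2 := by
    intro p
    have : p = p.1 • ((1, 0) : ℝ × ℝ) + p.2 • ((0, 1) : ℝ × ℝ) := by ext <;> simp
    conv_lhs => rw [this]
    rw [map_add, map_smul, map_smul, hs, ht]
    simp [mul_comm]
  let F : ℝ × ℝ → ℝ × ℝ := fun p => (p.1, M p)
  have hF : ContDiff ℝ (⊤ : ℕ∞) F := by fun_prop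
  let inv : ℝ × ℝ →L[ℝ] ℝ × ℝ := (ContinuousLinearMap.fst ℝ ℝ ℝ).prod
    (c⁻¹ • ContinuousLinearMap.snd ℝ ℝ ℝ - ContinuousLinearMap.fst ℝ ℝ ℝ)
  let F' : (ℝ × ℝ) ≃L[ℝ] ℝ × ℝ := ContinuousLinearEquiv.equivOfInverse
    ((ContinuousLinearMap.fst ℝ ℝ ℝ).prod (fderiv ℝ M 0)) inv
    (by
      intro p
      ext
      · simp [inv]
      · simp [inv, hMv]
        field_simp
        ring)
    (by
      intro p
      ext
      · simp [inv]
      · simp [inv, hMv]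
        field_simp
        ring)
  have hF' : HasFDerivAt F (F' : ℝ × ℝ →L[ℝ] ℝ × ℝ) 0 := by
    have := (hasFDerivAt_fst (𝕜 := ℝ) (p := (0 : ℝ × ℝ))).prodMk hM0
    exact this
  have hF0 : F 0 = 0 := by simp [F, h0]
  let e := (hF.contDiffAt (x := 0)).toOpenPartialHomeomorph F hF' (by simp)
  have hecoe : ∀ p, e p = F p := fun p => rfl
  have hsrc : (0 : ℝ × ℝ) ∈ e.source :=
    (hF.contDiffAt (x := 0)).mem_toOpenPartialHomeomorph_source hF' (by simp)
  have htgt : (0 : ℝ × ℝ) ∈ e.target := by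
    have := e.map_source hsrc
    rwa [hecoe, hF0] at this
  have hsymm0 : e.symm 0 = 0 := by
    have := e.left_inv hsrc
    rwa [hecoe, hF0] at this
  have hcont : ContinuousAt e.symm 0 := e.continuousAt_symm htgt
  have hev : ∀ᶠ q in 𝓝 (0 : ℝ × ℝ), q ∈ e.target ∧ ContDiffAt ℝ (⊤ : ℕ∞) e.symm q := by
    have hfc : Continuous (fderiv ℝ F) := hF.continuous_fderiv (by simp)
    have h1 : ContinuousAt (fun q => fderiv ℝ F (e.symm q)) 0 :=
      ContinuousAt.comp hfc.continuousAt hcont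
    have h2 : range ((↑) : ((ℝ × ℝ) ≃L[ℝ] ℝ × ℝ) → (ℝ × ℝ) →L[ℝ] ℝ × ℝ) ∈
        𝓝 (fderiv ℝ F (e.symm 0)) := by
      rw [hsymm0, hF'.fderiv]
      exact ContinuousLinearEquiv.nhds F'
    filter_upwards [h1 h2, e.open_target.mem_nhds htgt] with q hq hqt
    obtain ⟨E, hE⟩ := hq
    refine ⟨hqt, e.contDiffAt_symm hqt (f₀' := E) ?_ hF.contDiffAt⟩
    rw [hE]
    exact (hF.differentiable (by simp) _).hasFDerivAt
  let u : ℝ → ℝ := fun s => (e.symm (s, 0)).2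
  have hev2 : ∀ᶠ s in 𝓝 (0:ℝ), (s, (0:ℝ)) ∈ e.target ∧ ContDiffAt ℝ (⊤ : ℕ∞) u s := by
    have hc0 : Tendsto (fun s : ℝ => (s, (0:ℝ))) (𝓝 0) (𝓝 (0 : ℝ × ℝ)) :=
      (by fun_prop : Continuous (fun s : ℝ => (s, (0:ℝ)))).tendsto 0
    filter_upwards [hc0.eventually hev] with s hs
    refine ⟨hs.1, ?_⟩
    have h1 : ContDiffAt ℝ (⊤ : ℕ∞) (fun s : ℝ => (s, (0:ℝ))) s := by fun_prop
    exact (ContDiffAt.comp s (g := e.symm) (f := fun s : ℝ => (s, (0:ℝ))) hs.2 h1).snd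
  obtain ⟨δ, hδ, hδ'⟩ := Metric.eventually_nhds_iff.1 hev2
  obtain ⟨δ₂, hδ₂, hsub⟩ := Metric.isOpen_iff.1 e.open_source 0 hsrc
  simp only [Real.dist_eq, sub_zero] at hδ'
  obtain ⟨φ, hφ, hφu⟩ := aux_cut u δ hδ (fun x hx => (hδ' hx).2)
  have huiff : ∀ s t : ℝ, |s| < δ → (s, t) ∈ e.source → (M (s, t) = 0 ↔ t = u s) := by
    intro s t hs hst
    have hst' := (hδ' hs).1
    constructor
    · intro h
      have h1 := e.left_inv hst
      have h2 : e (s, t) = (s, 0) := by rw [hecoe]; simp [F, h]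
      rw [h2] at h1
      simp [u, h1]
    · intro h
      have h1 := e.right_inv hst'
      rw [hecoe] at h1
      simp only [F, Prod.mk.injEq] at h1
      have h3 : e.symm (s, 0) = (s, t) := by
        ext
        · exact h1.1
        · exact h.symm
      rw [← h3]
      exact h1.2
  have hφ0 : φ 0 = 0 := by
    rw [hφu 0 (by simpa using hδ)]
    show (e.symm (0, 0)).2 = 0
    have := hsymm0
    rw [show ((0:ℝ), (0:ℝ)) = 0 from rfl, hsymm0]
    rfl
  have hmain : ∀ s t : ℝ, |s| < min (δ/3) δ₂ → |t| < min (δ/3) δ₂ → (M (s, t) = 0 ↔ t = φ s) := by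
    intro s t hs ht
    have hs1 := lt_of_lt_of_le hs (min_le_left _ _)
    have hs2 := lt_of_lt_of_le hs (min_le_right _ _)
    have ht2 := lt_of_lt_of_le ht (min_le_right _ _)
    rw [hφu s hs1]
    refine huiff s t (by linarith) (hsub ?_)
    rw [mem_ball_zero_iff, Prod.norm_def]
    exact max_lt hs2 ht2
  have hε : 0 < min (δ/3) δ₂ := lt_min (by positivity) hδ₂
  refine ⟨min (δ/3) δ₂, φ, hε, hφ, hφ0, ?_, hmain⟩
  have hφd : HasDerivAt φ (deriv φ 0) 0 := (hφ.differentiable (by simp) 0).hasDerivAt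
  have hpair : HasDerivAt (fun s : ℝ => (s, φ s)) ((1, deriv φ 0) : ℝ × ℝ) 0 :=
    (hasDerivAt_id (0:ℝ)).prodMk hφd
  have hM0' : HasFDerivAt M (fderiv ℝ M 0) ((fun s : ℝ => (s, φ s)) 0) := by
    simp only [hφ0]
    exact hM0
  have hcomp := hM0'.comp_hasDerivAt (0:ℝ) hpair
  have hz : (M ∘ fun s : ℝ => (s, φ s)) =ᶠ[𝓝 0] fun _ => 0 := by
    have e1 : ∀ᶠ s in 𝓝 (0:ℝ), |s| < min (δ/3) δ₂ := by
      have : Tendsto (fun s : ℝ => |s|) (𝓝 0) (𝓝 |(0:ℝ)|) := continuous_abs.tendsto 0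
      rw [abs_zero] at this
      exact this.eventually (gt_mem_nhds hε)
    have e2 : ∀ᶠ s in 𝓝 (0:ℝ), |φ s| < min (δ/3) δ₂ := by
      have : Tendsto (fun s : ℝ => |φ s|) (𝓝 0) (𝓝 |φ 0|) :=
        (continuous_abs.comp hφ.continuous).tendsto 0
      rw [hφ0, abs_zero] at this
      exact this.eventually (gt_mem_nhds hε)
    filter_upwards [e1, e2] with s h1 h2
    exact (hmain s (φ s) h1 h2).2 rfl
  have := hcomp.unique ((hasDerivAt_const (0:ℝ) (0:ℝ)).congr_of_eventuallyEq hz)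
  rw [hMv] at this
  simp only at this
  apply mul_left_cancel₀ hc
  linarith

end helpers3

/-- For `y = f(x) = a₂x² + a₄x⁴ + a₅x⁵ + …` with `a₂ ≠ 0`, the degree-5 part of the
pre-symmetry set equation `g(s,t) = (γ(s)−γ(t))·(T(s)−T(t))` is
`2a₂(a₂³ − a₄)(s+t)(s−t)⁴`; and if `a₂³ ≠ a₄` (ordinary vertex, exact A₃ contact),
the zero set of `g` near the origin apart from the diagonal is a smooth curve
`t = φ(s)`, `φ(0) = 0`, `φ'(0) = −1`, transverse to the diagonal. -/
theorem stmt0 (a₂ a₄ a₅ : ℝ) (f : ℝ → ℝ) (ha : a₂ ≠ 0) (hf : ContDiff ℝ (⊤ : ℕ∞) f)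
    (hjet : (fun x => f x - (a₂*x^2 + a₄*x^4 + a₅*x^5)) =o[nhds (0:ℝ)] fun x => x^5) :
    ((fun p : ℝ × ℝ => preG f p.1 p.2 - 2*a₂*(a₂^3 - a₄)*(p.1+p.2)*(p.1-p.2)^4)
        =o[nhds (0 : ℝ × ℝ)] fun p : ℝ × ℝ => ‖p‖^5) ∧
    (a₂^3 ≠ a₄ → ∃ (ε : ℝ) (φ : ℝ → ℝ), 0 < ε ∧ ContDiff ℝ (⊤ : ℕ∞) φ ∧ φ 0 = 0 ∧
      deriv φ 0 = -1 ∧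
      ∀ s t : ℝ, |s| < ε → |t| < ε → s ≠ t → (preG f s t = 0 ↔ t = φ s)) := by
  have hpart1 := aux_part1 a₂ a₄ a₅ f hf hjet
  refine ⟨hpart1, fun hne => ?_⟩
  obtain ⟨L, hL, hL'⟩ := aux_L f hf
  let M : ℝ × ℝ → ℝ := fun p => L ((p.1 - p.2)/2, (p.1 + p.2)/2)
  have hM : ContDiff ℝ (⊤ : ℕ∞) M := by fun_prop
  have hGM : ∀ s t, preG f s t = ((s - t)/2)^4 * M (s, t) := by
    intro s t
    have := hL' ((s - t)/2) ((s + t)/2)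
    rw [show (s + t)/2 + (s - t)/2 = s by ring, show (s + t)/2 - (s - t)/2 = t by ring] at this
    exact this
  have hc : 32*a₂*(a₂^3 - a₄) ≠ 0 :=
    mul_ne_zero (mul_ne_zero (by norm_num) ha) (sub_ne_zero.2 hne)
  have hM0 : HasFDerivAt M (fderiv ℝ M 0) 0 := (hM.differentiable (by simp) 0).hasFDerivAt
  have ray : ∀ v : ℝ × ℝ, (v.1 - v.2)^4 = 1 → v.1 + v.2 = 1 →
      M 0 = 0 ∧ fderiv ℝ M 0 v = 32*a₂*(a₂^3 - a₄) := by
    intro v hv1 hv2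
    have htend : Filter.Tendsto (fun x : ℝ => x • v) (nhds 0) (nhds (0 : ℝ × ℝ)) := by
      have : Continuous (fun x : ℝ => x • v) := by fun_prop
      simpa using this.tendsto 0
    have h1 := hpart1.comp_tendsto htend
    have h2 : (fun x : ℝ => x^4 * M (x • v) - 32*a₂*(a₂^3 - a₄) * x^5) =o[nhds 0]
        fun x : ℝ => x^5 := by
      refine ((h1.const_mul_left 16).congr_left (fun x => ?_)).trans_isBigO
        (IsBigO.of_bound (‖v‖^5) (Filter.Eventually.of_forall fun x => ?_))
      · simp only [Function.comp, hGM, Prod.smul_fst, Prod.smul_snd, smul_eq_mul]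
        have : M (x * v.1, x * v.2) = M (x • v) := rfl
        rw [this]
        linear_combination (x^4 * M (x • v) - 32*a₂*(a₂^3 - a₄)*x^5*(v.1+v.2)) * hv1 -
          32*a₂*(a₂^3 - a₄)*x^5 * hv2
      · simp [norm_smul, mul_pow, mul_comm]
    obtain ⟨r1, r2⟩ := aux_ray _ (fun x : ℝ => M (x • v)) (by fun_prop) h2
    simp only [zero_smul] at r1
    refine ⟨r1, ?_⟩
    have h3 : HasDerivAt (fun x : ℝ => x • v) v 0 := by
      simpa using (hasDerivAt_id (0:ℝ)).smul_const v
    have hM0' : HasFDerivAt M (fderiv ℝ M 0) ((fun x : ℝ => x • v) 0) := by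
      simpa using hM0
    have h5 := hM0'.comp_hasDerivAt (0:ℝ) h3
    exact h5.unique r2
  obtain ⟨hz, hs⟩ := ray (1, 0) (by norm_num) (by norm_num)
  obtain ⟨_, ht⟩ := ray (0, 1) (by norm_num) (by norm_num)
  obtain ⟨ε, φ, hε, hφ, hφ0, hφ1, hiff⟩ := aux_ift M hM hz _ hc hs ht
  refine ⟨ε, φ, hε, hφ, hφ0, hφ1, fun s t h1 h2 hst => ?_⟩
  rw [← hiff s t h1 h2, hGM]
  have : ((s - t)/2)^4 ≠ 0 := pow_ne_zero _ (div_ne_zero (sub_ne_zero.2 hst) two_ne_zero)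
  simp [this]
end

section
/- For the plane curve y = a₂x² + a₂³x⁴ + a₅x⁵ + ... with a₂ ≠ 0 and a₅ ≠ 0 (A₄ contact of the osculating circle at the origin), the lowest-degree terms of the pre-symmetry set equation beyond the A₃ level are −a₂a₅(3s² + 4st + 3t²)(s−t)⁴; since the quadratic form 3s² + 4st + 3t² is positive definite, the pre-symmetry set near the origin consists, apart from the diagonal, of the isolated point s = t = 0. -/
open Asymptotics

lemma pow_bigO {k n : ℕ} (h : k ≤ n) : (fun x : ℝ => x^n) =O[nhds (0:ℝ)] fun x => x^k := by
  refine IsBigO.of_bound 1 ?_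
  filter_upwards [Metric.ball_mem_nhds (0:ℝ) one_pos] with x hx
  rw [norm_pow, norm_pow, one_mul]
  rw [mem_ball_zero_iff] at hx
  exact pow_le_pow_of_le_one (norm_nonneg _) hx.le h

/-- Taylor coefficients of a smooth `o(x^n)` function vanish. -/
lemma jet_iter_zero {r : ℝ → ℝ} (hr : ContDiff ℝ (⊤ : ℕ∞) r) (n : ℕ)
    (h : r =o[nhds (0:ℝ)] fun x => x^n) : ∀ k ≤ n, iteratedDeriv k r 0 = 0 := by
  intro k
  induction k using Nat.strong_induction_on with
  | _ k ih =>
    intro hk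
    have h1 := taylor_isLittleO_univ (x₀ := 0) (n := k) (hr.of_le (by exact_mod_cast le_top) : ContDiff ℝ k r)
    have h2 : r =o[nhds (0:ℝ)] fun x => x^k :=
      h.trans_isBigO (pow_bigO hk)
    simp only [sub_zero] at h1
    have h3 := h2.sub h1
    have h4 : (fun x : ℝ => ((k.factorial : ℝ)⁻¹ * iteratedDeriv k r 0) * x^k) =o[nhds (0:ℝ)]
        fun x => x^k := by
      refine (h3.congr' (Filter.Eventually.of_forall fun x => ?_)
        (Filter.Eventually.of_forall fun x => by simp))
      simp only [sub_sub_cancel, taylor_within_apply, iteratedDerivWithin_univ, sub_zero]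
      rw [Finset.sum_range_succ, Finset.sum_eq_zero]
      · simp; ring
      · intro j hj
        have hj' := Finset.mem_range.1 hj
        rw [ih j hj' (by omega)]; simp
    by_contra hne
    have hc : ((k.factorial : ℝ)⁻¹ * iteratedDeriv k r 0) ≠ 0 :=
      mul_ne_zero (by positivity) hne
    have h5 := (isLittleO_const_mul_left_iff hc).1 h4
    have h6 := isLittleO_irrefl (f'' := fun x : ℝ => x^k) (l := nhdsWithin (0:ℝ) {0}ᶜ) (by
      refine Filter.Eventually.frequently ?_
      filter_upwards [self_mem_nhdsWithin] with x hx
      exact pow_ne_zero _ hx)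
    exact h6 (h5.mono nhdsWithin_le_nhds)

lemma jet_deriv {r : ℝ → ℝ} (hr : ContDiff ℝ (⊤ : ℕ∞) r) (n : ℕ)
    (h : r =o[nhds (0:ℝ)] fun x => x^(n+1)) : deriv r =o[nhds (0:ℝ)] fun x => x^n := by
  have h0 := jet_iter_zero hr _ h
  have hd : ContDiff ℝ (⊤ : ℕ∞) (deriv r) := (contDiff_infty_iff_deriv.1 hr).2
  have h1 := taylor_isLittleO_univ (x₀ := 0) (n := n) (hd.of_le (by exact_mod_cast le_top) : ContDiff ℝ n (deriv r))
  refine (h1.congr' (Filter.Eventually.of_forall fun x => ?_)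
        (Filter.Eventually.of_forall fun x => by simp))
  simp only [taylor_within_apply, iteratedDerivWithin_univ, sub_zero]
  rw [Finset.sum_eq_zero, sub_zero]
  intro j hj
  have hj' := Finset.mem_range.1 hj
  rw [← iteratedDeriv_succ', h0 (j+1) (by omega)]; simp

lemma jet_deriv_sub {f P P' : ℝ → ℝ} (hf : ContDiff ℝ (⊤ : ℕ∞) f) (hP : ContDiff ℝ (⊤ : ℕ∞) P)
    (hP' : ∀ x, HasDerivAt P (P' x) x) (n : ℕ)
    (h : (fun x => f x - P x) =o[nhds (0:ℝ)] fun x => x^(n+1)) :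
    (fun x => deriv f x - P' x) =o[nhds (0:ℝ)] fun x => x^n := by
  have := jet_deriv (hf.sub hP) n h
  refine this.congr_left fun x => ?_
  have h1 : HasDerivAt f (deriv f x) x := ((hf.differentiable (by simp)) x).hasDerivAt
  exact (h1.sub (hP' x)).deriv

lemma strictMono_off {F F' : ℝ → ℝ} (hd : ∀ x, HasDerivAt F (F' x) x) {p q c : ℝ}
    (hc : c ∈ Set.Icc p q) (h : ∀ x ∈ Set.Icc p q, x ≠ c → 0 < F' x) :
    StrictMonoOn F (Set.Icc p q) := by
  have hcont : Continuous F := continuous_iff_continuousAt.2 fun x => (hd x).continuousAt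
  have h1 : StrictMonoOn F (Set.Icc p c) := by
    refine strictMonoOn_of_deriv_pos (convex_Icc _ _) hcont.continuousOn fun x hx => ?_
    rw [interior_Icc] at hx
    rw [(hd x).deriv]
    exact h x ⟨hx.1.le, hx.2.le.trans hc.2⟩ hx.2.ne
  have h2 : StrictMonoOn F (Set.Icc c q) := by
    refine strictMonoOn_of_deriv_pos (convex_Icc _ _) hcont.continuousOn fun x hx => ?_
    rw [interior_Icc] at hx
    rw [(hd x).deriv]
    exact h x ⟨hc.1.trans hx.1.le, hx.2.le⟩ hx.1.ne'
  have := h1.union h2 (isGreatest_Icc hc.1) (isLeast_Icc hc.2)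
  rwa [Set.Icc_union_Icc_eq_Icc hc.1 hc.2] at this

lemma mul_sub_pos {F : ℝ → ℝ} {D : Set ℝ} (h : StrictMonoOn F D) {x y : ℝ} (hx : x ∈ D)
    (hy : y ∈ D) (hne : x ≠ y) : 0 < (F x - F y) * (x - y) := by
  rcases lt_or_gt_of_ne hne with hl | hl
  · exact mul_pos_of_neg_of_neg (by linarith [h hx hy hl]) (by linarith)
  · exact mul_pos (by linarith [h hy hx hl]) (by linarith)

/-- Monotone curvature (vertex-free arc) excludes off-diagonal zeros. -/
lemma no_zero {f u v w : ℝ → ℝ} (hf : ∀ x, HasDerivAt f (u x) x) (hu : ∀ x, HasDerivAt u (v x) x)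
    (hv : ∀ x, HasDerivAt v (w x) x) {a b ε : ℝ}
    (hpos : ∀ x, |x| < ε → 0 < a * v x)
    (hk : ∀ x, |x| < ε → x ≠ 0 → 0 < b * (w x * (1 + u x^2) - 3 * u x * v x^2))
    {s t : ℝ} (hs : |s| < ε) (ht : |t| < ε) (hst : s < t) : preG f s t ≠ 0 := by
  have hdf : ∀ x, deriv f x = u x := fun x => (hf x).deriv
  obtain ⟨δ, hδs, hδt, hδ0, hδ⟩ : ∃ δ, |s| ≤ δ ∧ |t| ≤ δ ∧ 0 ≤ δ ∧ δ < ε :=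
    ⟨max |s| |t|, le_max_left _ _, le_max_right _ _, (abs_nonneg s).trans (le_max_left _ _),
      max_lt hs ht⟩
  have hδε : ∀ x ∈ Set.Icc (-δ) δ, |x| < ε := fun x hx => (abs_le.2 hx).trans_lt hδ
  set S : ℝ → ℝ := fun x => Real.sqrt (1 + u x^2) with hS
  have hS0 : ∀ x, 0 < S x := fun x => Real.sqrt_pos.2 (by positivity)
  have hS2 : ∀ x, S x^2 = 1 + u x^2 := fun x => Real.sq_sqrt (by positivity)
  have hSd : ∀ x, HasDerivAt S (u x * v x / S x) x := by
    intro x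
    have h1 : HasDerivAt (fun x => 1 + u x^2) (2 * u x * v x) x := by
      have := ((hu x).pow 2).const_add 1
      exact this.congr_deriv (by simp)
    have := h1.sqrt (by positivity)
    refine this.congr_deriv ?_
    have := (hS0 x).ne'
    simp only [hS] at this ⊢
    field_simp
  set T1 : ℝ → ℝ := fun x => (S x)⁻¹ with hT1
  set T2 : ℝ → ℝ := fun x => (S x)⁻¹ * u x with hT2
  set κ : ℝ → ℝ := fun x => v x / S x^3 with hκ
  have hT1d : ∀ x, HasDerivAt T1 (-(κ x * u x)) x := by
    intro x
    have := (hSd x).inv (hS0 x).ne'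
    refine this.congr_deriv ?_
    have := (hS0 x).ne'
    simp only [hκ]; field_simp
  have hT2d : ∀ x, HasDerivAt T2 (κ x) x := by
    intro x
    have := (hT1d x).mul (hu x)
    refine this.congr_deriv ?_
    have h0 := (hS0 x).ne'
    simp only [hκ, hT1]; field_simp
    rw [hS2]; ring
  have hκd : ∀ x, HasDerivAt κ ((w x * (1 + u x^2) - 3 * u x * v x^2) / S x^5) x := by
    intro x
    have h0 := (hS0 x).ne'
    have := (hv x).div ((hSd x).pow 3) (pow_ne_zero 3 h0)
    refine this.congr_deriv ?_
    rw [← hS2]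
    simp
    field_simp

  have hκpos : ∀ x, |x| < ε → 0 < a * κ x := by
    intro x hx
    have := div_pos (hpos x hx) (pow_pos (hS0 x) 3)
    simpa only [hκ, mul_div_assoc] using this
  have hmu : StrictMonoOn (fun x => a * u x) (Set.Icc (-δ) δ) :=
    strictMono_off (fun x => (hu x).const_mul a) (c := 0) ⟨by linarith, hδ0⟩
      fun x hx _ => hpos x (hδε x hx)
  have hmT : StrictMonoOn (fun x => a * T2 x) (Set.Icc (-δ) δ) :=
    strictMono_off (fun x => (hT2d x).const_mul a) (c := 0) ⟨by linarith, hδ0⟩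
      fun x hx _ => hκpos x (hδε x hx)
  have hmκ : StrictMonoOn (fun x => b * κ x) (Set.Icc (-δ) δ) :=
    strictMono_off (fun x => (hκd x).const_mul b) (c := 0) ⟨by linarith, hδ0⟩
      fun x hx hx0 => by
        have := div_pos (hk x (hδε x hx) hx0) (pow_pos (hS0 x) 5)
        simpa only [mul_div_assoc] using this
  have hsm : s ∈ Set.Icc (-δ) δ := abs_le.1 hδs
  have htm : t ∈ Set.Icc (-δ) δ := abs_le.1 hδt
  set W1 := T1 t - T1 s with hW1
  set W2 := T2 t - T2 s with hW2
  have hW2ne : W2 ≠ 0 := by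
    intro h0
    have := hmT hsm htm hst
    simp only at this
    have h1 : T2 t = T2 s := by linarith
    rw [h1] at this; exact lt_irrefl _ this
  have hG : ∀ x, HasDerivAt (fun x => W1 * T2 x - W2 * T1 x) (κ x * (W1 + u x * W2)) x := by
    intro x
    refine (((hT2d x).const_mul W1).sub ((hT1d x).const_mul W2)).congr_deriv ?_
    ring
  obtain ⟨c, hc, hc0⟩ := exists_hasDerivAt_eq_zero hst
    (f := fun x => W1 * T2 x - W2 * T1 x)
    (continuous_iff_continuousAt.2 fun x => (hG x).continuousAt).continuousOn
    (by simp only [hW1, hW2]; ring) (fun x _ => hG x)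
  have hsub : Set.Icc s t ⊆ Set.Icc (-δ) δ := Set.Icc_subset_Icc hsm.1 htm.2
  have hcI : c ∈ Set.Icc s t := ⟨hc.1.le, hc.2.le⟩
  have hκc := hκpos c (hδε c (hsub hcI))
  have hκc0 : κ c ≠ 0 := by rintro h; rw [h] at hκc; simp at hκc
  have hψ : W1 + u c * W2 = 0 := (mul_eq_zero.1 hc0).resolve_left hκc0
  have hF : ∀ x, HasDerivAt
      (fun x => a * b * W2 * ((W1 * T2 x - W2 * T1 x) - κ c * (W1 * x + W2 * f x)))
      (a * b * W2 * ((κ x - κ c) * (W2 * (u x - u c)))) x := by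
    intro x
    have := ((hG x).sub ((((hasDerivAt_id x).const_mul W1).add
      ((hf x).const_mul W2)).const_mul (κ c))).const_mul (a * b * W2)
    refine this.congr_deriv ?_
    have : W1 = - (u c * W2) := by linarith
    rw [this]; ring
  have hmF := strictMono_off hF (p := s) (q := t) hcI (by
    intro x hx hxc
    have h1 := mul_sub_pos hmu (hsub hx) (hsub hcI) hxc
    have h2 := mul_sub_pos hmκ (hsub hx) (hsub hcI) hxc
    have h3 := mul_pos h1 h2
    have h4 : 0 < (x - c)^2 := by have := sub_ne_zero.2 hxc; positivity
    have h5 : 0 < W2^2 := by positivity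
    have h6 : 0 < (a * (u x - u c)) * (b * (κ x - κ c)) := by
      refine pos_of_mul_pos_left (b := (x-c)^2) ?_ h4.le
      calc _ < _ := h3
        _ = _ := by ring
    calc 0 < _ := mul_pos h5 h6
      _ = _ := by ring)
  have hlt := hmF ⟨le_rfl, hst.le⟩ ⟨hst.le, le_rfl⟩ hst
  have hpre : preG f s t = W1 * (t - s) + W2 * (f t - f s) := by
    simp only [preG, tangentG, hdf, hW1, hW2, hT1, hT2, hS, Prod.smul_mk, smul_eq_mul, mul_one]
    ring
  intro h0
  rw [hpre] at h0
  refine hlt.ne ?_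
  simp only
  have h7 : W1 * T2 t - W2 * T1 t = W1 * T2 s - W2 * T1 s := by simp only [hW1, hW2]; ring
  rw [h7]
  linear_combination (a * b * W2 * κ c) * h0

lemma pow_mul_littleO (n : ℕ) {c : ℝ → ℝ} (hc : Continuous c) :
    (fun x : ℝ => x^(n+1) * c x) =o[nhds (0:ℝ)] fun x => x^n := by
  have h1 : (fun x : ℝ => x * c x) =o[nhds (0:ℝ)] fun _ => (1:ℝ) := by
    rw [isLittleO_one_iff]
    have : Continuous fun x : ℝ => x * c x := by fun_prop
    simpa using this.tendsto 0
  have := (isBigO_refl (fun x : ℝ => x^n) (nhds 0)).mul_isLittleO h1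
  exact this.congr (fun x => by ring) (fun x => by ring)

lemma bigO_one_of_cont {c : ℝ → ℝ} (hc : Continuous c) :
    c =O[nhds (0:ℝ)] fun _ => (1:ℝ) := (hc.tendsto 0).isBigO_one ℝ

lemma pow_mul_bigO (n : ℕ) {c : ℝ → ℝ} (hc : Continuous c) :
    (fun x : ℝ => x^n * c x) =O[nhds (0:ℝ)] fun x => x^n := by
  have := (isBigO_refl (fun x : ℝ => x^n) (nhds 0)).mul (bigO_one_of_cont hc)
  exact this.congr (fun x => by ring) (fun x => by ring)

lemma fst_bigO (n : ℕ) : (fun p : ℝ × ℝ => p.1^n) =O[nhds 0] fun p : ℝ × ℝ => ‖p‖^n := by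
  refine IsBigO.of_bound 1 (Filter.Eventually.of_forall fun p => ?_)
  rw [norm_pow, norm_pow, one_mul, norm_norm]
  exact pow_le_pow_left₀ (norm_nonneg _) (norm_fst_le p) n

lemma snd_bigO (n : ℕ) : (fun p : ℝ × ℝ => p.2^n) =O[nhds 0] fun p : ℝ × ℝ => ‖p‖^n := by
  refine IsBigO.of_bound 1 (Filter.Eventually.of_forall fun p => ?_)
  rw [norm_pow, norm_pow, one_mul, norm_norm]
  exact pow_le_pow_left₀ (norm_nonneg _) (norm_snd_le p) n

lemma tendsto_fst0 : Filter.Tendsto (fun p : ℝ × ℝ => p.1) (nhds 0) (nhds 0) :=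
  continuous_fst.tendsto (0 : ℝ × ℝ)

lemma tendsto_snd0 : Filter.Tendsto (fun p : ℝ × ℝ => p.2) (nhds 0) (nhds 0) :=
  continuous_snd.tendsto (0 : ℝ × ℝ)

lemma diff_littleO {r : ℝ → ℝ} {n : ℕ} (h : r =o[nhds (0:ℝ)] fun x => x^n) :
    (fun p : ℝ × ℝ => r p.1 - r p.2) =o[nhds 0] fun p : ℝ × ℝ => ‖p‖^n :=
  ((h.comp_tendsto tendsto_fst0).trans_isBigO (fst_bigO n)).sub
    ((h.comp_tendsto tendsto_snd0).trans_isBigO (snd_bigO n))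

lemma diff_bigO {r : ℝ → ℝ} {n : ℕ} (h : r =O[nhds (0:ℝ)] fun x => x^n) :
    (fun p : ℝ × ℝ => r p.1 - r p.2) =O[nhds 0] fun p : ℝ × ℝ => ‖p‖^n :=
  ((h.comp_tendsto tendsto_fst0).trans (fst_bigO n)).sub
    ((h.comp_tendsto tendsto_snd0).trans (snd_bigO n))

/-- Expansion of the first component of the unit tangent. -/
lemma T1_jet {u : ℝ → ℝ} (hc : Continuous u) (a b : ℝ)
    (hu : (fun x => u x - (2*a*x + 4*a^3*x^3 + 5*b*x^4)) =o[nhds (0:ℝ)] fun x => x^4) :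
    (fun x => (Real.sqrt (1 + u x^2))⁻¹ - (1 - 2*a^2*x^2 - 2*a^4*x^4 - 10*a*b*x^5))
      =o[nhds (0:ℝ)] fun x => x^5 := by
  have hup : (fun x => u x + (2*a*x + 4*a^3*x^3 + 5*b*x^4)) =O[nhds (0:ℝ)] fun x => x^1 := by
    have h1 := (hu.isBigO.trans (pow_bigO (show 1 ≤ 4 by norm_num))).add
      (pow_mul_bigO 1 (c := fun x => 2*(2*a + 4*a^3*x^2 + 5*b*x^3)) (by fun_prop))
    exact h1.congr_left fun x => by ring
  have hR : (fun x => 1 - (1 + u x^2) * (1 - 2*a^2*x^2 - 2*a^4*x^4 - 10*a*b*x^5)^2)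
      =o[nhds (0:ℝ)] fun x => x^5 := by
    have h1 := ((hu.mul_isBigO hup).mul_isBigO (bigO_one_of_cont
      (c := fun x => (1 - 2*a^2*x^2 - 2*a^4*x^4 - 10*a*b*x^5)^2) (by fun_prop)))
    have h2 := pow_mul_littleO 5 (c := fun x => (-25)*a^0*b^2*x^2 + (500)*a^1*b^3*x^7 + (400)*a^2*b^2*x^4 + (-2500)*a^2*b^4*x^12 +
      (80)*a^3*b^1*x^1 + (-3000)*a^3*b^3*x^9 + (-400)*a^4*b^2*x^6 + (280)*a^5*b^1*x^3 +
      (-5000)*a^5*b^3*x^11 + (40)*a^6*b^0*x^0 + (-4200)*a^6*b^2*x^8 + (-640)*a^7*b^1*x^5 +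
      (28)*a^8*b^0*x^2 + (-3300)*a^8*b^2*x^10 + (-1680)*a^9*b^1*x^7 + (-144)*a^10*b^0*x^4 +
      (-800)*a^11*b^1*x^9 + (-192)*a^12*b^0*x^6 + (-64)*a^14*b^0*x^8) (by fun_prop)
    have h1' := h1.congr_right (g₂ := fun x => x^5) fun x => by ring
    refine (h2.sub h1').congr_left fun x => ?_
    ring
  refine IsBigO.trans_isLittleO (IsBigO.of_bound 2 ?_) hR
  have hQ : ∀ᶠ x in nhds (0:ℝ), 1/2 < 1 - 2*a^2*x^2 - 2*a^4*x^4 - 10*a*b*x^5 := by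
    have : Continuous fun x : ℝ => 1 - 2*a^2*x^2 - 2*a^4*x^4 - 10*a*b*x^5 := by fun_prop
    refine (this.tendsto 0).eventually_const_lt ?_
    norm_num
  filter_upwards [hQ] with x hx
  generalize 1 - 2*a^2*x^2 - 2*a^4*x^4 - 10*a*b*x^5 = q at hx ⊢
  have hpos : 0 < 1 + u x^2 := by positivity
  have hy : 0 < (Real.sqrt (1 + u x^2))⁻¹ := inv_pos.2 (Real.sqrt_pos.2 hpos)
  have hy2 : (1 + u x^2) * (Real.sqrt (1 + u x^2))⁻¹^2 = 1 := by
    rw [inv_pow, Real.sq_sqrt hpos.le, mul_inv_cancel₀ hpos.ne']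
  generalize (Real.sqrt (1 + u x^2))⁻¹ = y at hy hy2 ⊢
  have h1 : 1 - (1 + u x^2) * q^2 = (y - q) * ((1 + u x^2) * (y + q)) := by
    linear_combination -hy2
  rw [h1, norm_mul]
  have h2 : (1:ℝ)/2 ≤ ‖(1 + u x^2) * (y + q)‖ := by
    rw [Real.norm_eq_abs]
    refine le_trans ?_ (le_abs_self _)
    nlinarith [sq_nonneg (u x), mul_nonneg (sq_nonneg (u x)) (by linarith : 0 ≤ y + q)]
  nlinarith [norm_nonneg (y - q)]

/-- Expansion of the second component of the unit tangent. -/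
lemma T2_jet {u y : ℝ → ℝ} (a b : ℝ) (hyc : Continuous y)
    (hu : (fun x => u x - (2*a*x + 4*a^3*x^3 + 5*b*x^4)) =o[nhds (0:ℝ)] fun x => x^4)
    (hy : (fun x => y x - (1 - 2*a^2*x^2 - 2*a^4*x^4 - 10*a*b*x^5)) =o[nhds (0:ℝ)] fun x => x^5) :
    (fun x => y x * u x - (2*a*x + 5*b*x^4)) =o[nhds (0:ℝ)] fun x => x^4 := by
  have h1 := (hu.mul_isBigO (bigO_one_of_cont hyc)).congr_right (g₂ := fun x => x^4)
    fun x => by ring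
  have h2 := ((hy.trans_isBigO (pow_bigO (show 4 ≤ 5 by norm_num))).mul_isBigO
    (bigO_one_of_cont (c := fun x => 2*a*x + 4*a^3*x^3 + 5*b*x^4) (by fun_prop))).congr_right
    (g₂ := fun x => x^4) fun x => by ring
  have h3 := pow_mul_littleO 4 (c := fun x => (-50)*a^1*b^2*x^4 + (-30)*a^2*b^1*x^1 + (-50)*a^4*b^1*x^3 + (-12)*a^5*b^0*x^0 +
      (-8)*a^7*b^0*x^2) (by fun_prop)
  refine ((h1.add h2).add h3).congr_left fun x => ?_
  ring

lemma part_one (a b : ℝ) {f : ℝ → ℝ} (hf : ContDiff ℝ (⊤ : ℕ∞) f)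
    (hj : (fun x => f x - (a*x^2 + a^3*x^4 + b*x^5)) =o[nhds (0:ℝ)] fun x => x^5)
    (hu : (fun x => deriv f x - (2*a*x + 4*a^3*x^3 + 5*b*x^4)) =o[nhds (0:ℝ)] fun x => x^4) :
    (fun p : ℝ × ℝ => preG f p.1 p.2 - (-(a*b))*(3*p.1^2 + 4*p.1*p.2 + 3*p.2^2)*(p.1-p.2)^4)
        =o[nhds (0 : ℝ × ℝ)] fun p : ℝ × ℝ => ‖p‖^6 := by
  have hc : Continuous (deriv f) := hf.continuous_deriv (by simp)
  have hyc : Continuous fun x => (Real.sqrt (1 + deriv f x^2))⁻¹ := by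
    refine Continuous.inv₀ (by fun_prop) fun x => ?_
    exact (Real.sqrt_pos.2 (by positivity)).ne'
  have e1 := T1_jet hc a b hu
  have e2 := T2_jet a b hyc hu e1
  have hT2 : (fun x => (Real.sqrt (1 + deriv f x^2))⁻¹ * deriv f x) =O[nhds (0:ℝ)]
      fun x => x^1 := by
    refine ((e2.isBigO.trans (pow_bigO (show 1 ≤ 4 by norm_num))).add
      (pow_mul_bigO 1 (c := fun x => 2*a + 5*b*x^3) (by fun_prop))).congr_left fun x => ?_
    ring
  have k1 := (diff_bigO (r := fun x => x) (n := 1) (by simpa using isBigO_refl _ _)).mul_isLittleO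
    (diff_littleO e1)
  have k2 := (diff_bigO (pow_mul_bigO 2 (c := fun x => a + a^3*x^2 + b*x^3)
    (by fun_prop))).mul_isLittleO (diff_littleO e2)
  have k3 := (diff_littleO hj).mul_isBigO (diff_bigO hT2)
  have k4 := (diff_bigO (pow_mul_bigO 4 (c := fun x => 5*b)
    (by fun_prop))).mul_isLittleO (diff_littleO (pow_mul_littleO 2 (c := fun x => a^3*x + b*x^2)
    (by fun_prop)))
  have k1' := k1.congr_right (g₂ := fun p => ‖p‖^6) fun p => by ring
  have k2' := k2.congr_right (g₂ := fun p => ‖p‖^6) fun p => by ring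
  have k3' := k3.congr_right (g₂ := fun p => ‖p‖^6) fun p => by ring
  have k4' := k4.congr_right (g₂ := fun p => ‖p‖^6) fun p => by ring
  refine (((k1'.add k2').add k3').add k4').congr_left fun p => ?_
  simp only [preG, tangentG, Prod.smul_mk, smul_eq_mul, mul_one]
  ring

lemma curv_jet (a b : ℝ) {u v w : ℝ → ℝ} (hvc : Continuous v)
    (hu : (fun x => u x - (2*a*x + 4*a^3*x^3 + 5*b*x^4)) =o[nhds (0:ℝ)] fun x => x^4)
    (hv : (fun x => v x - (2*a + 12*a^3*x^2 + 20*b*x^3)) =o[nhds (0:ℝ)] fun x => x^3)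
    (hw : (fun x => w x - (24*a^3*x + 60*b*x^2)) =o[nhds (0:ℝ)] fun x => x^2) :
    (fun x => (w x * (1 + u x^2) - 3 * u x * v x^2) - 60*b*x^2) =o[nhds (0:ℝ)] fun x => x^2 := by
  have hu1 : (fun x => u x - 2*a*x) =o[nhds (0:ℝ)] fun x => x^2 :=
    ((hu.trans_isBigO (pow_bigO (show 2 ≤ 4 by norm_num))).add
      (pow_mul_littleO 2 (c := fun x => 4*a^3 + 5*b*x) (by fun_prop))).congr_left fun x => by ring
  have hu2 : u =O[nhds (0:ℝ)] fun x => x^1 :=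
    ((hu1.isBigO.trans (pow_bigO (show 1 ≤ 2 by norm_num))).add
      (pow_mul_bigO 1 (c := fun x => 2*a) (by fun_prop))).congr_left fun x => by ring
  have hv1 : (fun x => v x - 2*a) =o[nhds (0:ℝ)] fun x => x^1 :=
    ((hv.trans_isBigO (pow_bigO (show 1 ≤ 3 by norm_num))).add
      (pow_mul_littleO 1 (c := fun x => 12*a^3 + 20*b*x) (by fun_prop))).congr_left
      fun x => by ring
  have hw1 : w =o[nhds (0:ℝ)] fun x => x^0 :=
    ((hw.trans_isBigO (pow_bigO (show 0 ≤ 2 by norm_num))).add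
      (pow_mul_littleO 0 (c := fun x => 24*a^3 + 60*b*x) (by fun_prop))).congr_left
      fun x => by ring
  have k1 := (hw1.mul_isBigO (hu2.mul hu2)).congr_right (g₂ := fun x => x^2) fun x => by ring
  have k2 := (hu1.mul_isBigO (bigO_one_of_cont (c := fun x => -3 * v x^2)
    (by fun_prop))).congr_right (g₂ := fun x => x^2) fun x => by ring
  have k3 := (hv1.mul_isBigO (pow_mul_bigO 1 (c := fun x => -6*a*(v x + 2*a))
    (by fun_prop))).congr_right (g₂ := fun x => x^2) fun x => by ring
  refine (((hw.add k1).add k2).add k3).congr_left fun x => ?_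
  ring

theorem stmt1 (a₂ a₅ : ℝ) (f : ℝ → ℝ) (ha : a₂ ≠ 0) (ha5 : a₅ ≠ 0)
    (hf : ContDiff ℝ (⊤ : ℕ∞) f)
    (hjet : (fun x => f x - (a₂*x^2 + a₂^3*x^4 + a₅*x^5)) =o[nhds (0:ℝ)] fun x => x^5) :
    ((fun p : ℝ × ℝ => preG f p.1 p.2 - (-(a₂*a₅))*(3*p.1^2 + 4*p.1*p.2 + 3*p.2^2)*(p.1-p.2)^4)
        =o[nhds (0 : ℝ × ℝ)] fun p : ℝ × ℝ => ‖p‖^6) ∧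
    (∀ s t : ℝ, (s, t) ≠ ((0:ℝ), (0:ℝ)) → 0 < 3*s^2 + 4*s*t + 3*t^2) ∧
    (∃ ε : ℝ, 0 < ε ∧ ∀ s t : ℝ, |s| < ε → |t| < ε → s ≠ t → preG f s t ≠ 0) := by
  have hf1 : ContDiff ℝ (⊤ : ℕ∞) (deriv f) := (contDiff_infty_iff_deriv.1 hf).2
  have hf2 : ContDiff ℝ (⊤ : ℕ∞) (deriv (deriv f)) := (contDiff_infty_iff_deriv.1 hf1).2
  have hd : ∀ {g : ℝ → ℝ}, ContDiff ℝ (⊤ : ℕ∞) g → ∀ x, HasDerivAt g (deriv g x) x :=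
    fun hg x => ((contDiff_infty_iff_deriv.1 hg).1 x).hasDerivAt
  have hm : ∀ (n : ℕ) (c x : ℝ), HasDerivAt (fun x : ℝ => c * x^n) (c * (n * x^(n-1))) x :=
    fun n c x => (hasDerivAt_pow n x).const_mul c
  have hu : (fun x => deriv f x - (2*a₂*x + 4*a₂^3*x^3 + 5*a₅*x^4)) =o[nhds (0:ℝ)]
      fun x => x^4 := by
    refine jet_deriv_sub hf (by fun_prop) (fun x => ?_) 4 hjet
    refine (((hm 2 a₂ x).add (hm 4 (a₂^3) x)).add (hm 5 a₅ x)).congr_deriv ?_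
    push_cast; ring
  have hv : (fun x => deriv (deriv f) x - (2*a₂ + 12*a₂^3*x^2 + 20*a₅*x^3)) =o[nhds (0:ℝ)]
      fun x => x^3 := by
    refine jet_deriv_sub hf1 (P := fun x => 2*a₂*x^1 + 4*a₂^3*x^3 + 5*a₅*x^4) (by fun_prop)
      (fun x => ?_) 3 (hu.congr_left fun x => by ring)
    refine (((hm 1 (2*a₂) x).add (hm 3 (4*a₂^3) x)).add (hm 4 (5*a₅) x)).congr_deriv ?_
    push_cast; ring
  have hw : (fun x => deriv (deriv (deriv f)) x - (24*a₂^3*x + 60*a₅*x^2)) =o[nhds (0:ℝ)]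
      fun x => x^2 := by
    refine jet_deriv_sub hf2 (P := fun x => 2*a₂*x^0 + 12*a₂^3*x^2 + 20*a₅*x^3) (by fun_prop)
      (fun x => ?_) 2 (hv.congr_left fun x => by ring)
    refine (((hm 0 (2*a₂) x).add (hm 2 (12*a₂^3) x)).add (hm 3 (20*a₅) x)).congr_deriv ?_
    push_cast; ring
  refine ⟨part_one a₂ a₅ hf hjet hu, ?_, ?_⟩
  · intro s t hst
    have hst' : s ≠ 0 ∨ t ≠ 0 := by
      by_contra! h
      exact hst (by rw [h.1, h.2])
    rcases hst' with h | h
    · have : 0 < s^2 := by positivity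
      nlinarith [sq_nonneg (s + t), sq_nonneg t]
    · have : 0 < t^2 := by positivity
      nlinarith [sq_nonneg (s + t), sq_nonneg s]
  · have hM := curv_jet a₂ a₅ hf2.continuous hu hv hw
    have hv0 : deriv (deriv f) 0 = 2*a₂ := by
      have h1 := (hv.bound one_pos).self_of_nhds
      norm_num at h1
      linarith
    have ev1 : ∀ᶠ x in nhds (0:ℝ), 0 < a₂ * deriv (deriv f) x := by
      have hc : Continuous fun x => a₂ * deriv (deriv f) x := hf2.continuous.const_mul a₂
      refine (hc.tendsto 0).eventually_const_lt ?_
      rw [hv0]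
      have : 0 < a₂^2 := by positivity
      linarith
    have ev2 : ∀ᶠ x in nhds (0:ℝ), x ≠ 0 → 0 < a₅ * (deriv (deriv (deriv f)) x *
        (1 + deriv f x^2) - 3 * deriv f x * deriv (deriv f) x^2) := by
      have h5 : 0 < |a₅| := abs_pos.2 ha5
      filter_upwards [hM.bound h5] with x hx hx0
      generalize deriv (deriv (deriv f)) x *
        (1 + deriv f x^2) - 3 * deriv f x * deriv (deriv f) x^2 = M at hx ⊢
      have hx2 : 0 < x^2 := by positivity
      rw [Real.norm_eq_abs, Real.norm_eq_abs, abs_of_pos hx2] at hx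
      have h6 : |a₅ * (M - 60*a₅*x^2)| ≤ a₅^2 * x^2 := by
        rw [abs_mul, ← sq_abs a₅]
        nlinarith
      have h7 := neg_le_of_abs_le h6
      have h8 : 0 < a₅^2 * x^2 := by positivity
      nlinarith
    obtain ⟨ε, hε, hball⟩ := Metric.eventually_nhds_iff.1 (ev1.and ev2)
    refine ⟨ε, hε, fun s t hs ht hst => ?_⟩
    have key : ∀ {s t : ℝ}, |s| < ε → |t| < ε → s < t → preG f s t ≠ 0 := fun hs ht hst =>
      no_zero (hd hf) (hd hf1) (hd hf2) (fun x hx => (hball (by simpa using hx)).1)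
        (fun x hx => (hball (by simpa using hx)).2) hs ht hst
    rcases lt_or_gt_of_ne hst with h | h
    · exact key hs ht h
    · have hsymm : preG f s t = preG f t s := by simp only [preG]; ring
      rw [hsymm]
      exact key ht hs h
end
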